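/- Let A be a finite alphabet with |A| ≥ 2 and k a positive integer. Every regular code X ⊆ A* that is P̲_k-independent (i.e., there is no pair x, y ∈ X with x ≠ y and d_P(x,y) ≤ k) can be embedded into a complete code Z ⊇ X that is still P̲_k-independent (and may be taken regular). -/

import Mathlib

open scoped ENNReal

/-- Length of a longest common prefix of `w` and `w'`. -/
noncomputable def lcpLen {A : Type*} (w w' : List A) : ℕ :=
  sSup {n | ∃ p : List A, p.length = n ∧ p <+: w ∧ p <+: w'}

/-- The prefix distance `d_P(w,w') = |w| + |w'| - 2|w ∧ w'|`. -/
noncomputable def dP {A : Type*} (w w' : List A) : ℕ :=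
  w.length + w'.length - 2 * lcpLen w w'

/-- Length of a longest common suffix of `w` and `w'`. -/
noncomputable def lcsLen {A : Type*} (w w' : List A) : ℕ :=
  sSup {n | ∃ s : List A, s.length = n ∧ s <:+ w ∧ s <:+ w'}

/-- The suffix distance `d_S(w,w') = |w| + |w'| - 2|s|`. -/
noncomputable def dS {A : Type*} (w w' : List A) : ℕ :=
  w.length + w'.length - 2 * lcsLen w w'

/-- Length of a longest common factor of `w` and `w'`. -/
noncomputable def lcfLen {A : Type*} (w w' : List A) : ℕ :=
  sSup {n | ∃ f : List A, f.length = n ∧ f <:+: w ∧ f <:+: w'}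

/-- The factor distance `d_F(w,w') = |w| + |w'| - 2|f|`,
`f` a maximum-length common factor. -/
noncomputable def dF {A : Type*} (w w' : List A) : ℕ :=
  w.length + w'.length - 2 * lcfLen w w'

/-- `n`-fold composition of a binary relation. -/
def relPow {α : Type*} (r : α → α → Prop) : ℕ → α → α → Prop
  | 0 => Eq
  | n + 1 => Relation.Comp (relPow r n) r

/-- `X` is a (variable-length) code: every word of `X*` factorizes uniquely over `X`. -/
def IsCode {A : Type*} (X : Set (List A)) : Prop :=
  ∀ l m : List (List A), (∀ x ∈ l, x ∈ X) → (∀ x ∈ m, x ∈ X) →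
    l.flatten = m.flatten → l = m

/-- `X` is complete: every word is a factor of some word of `X*`. -/
def IsCompleteSet {A : Type*} (X : Set (List A)) : Prop :=
  ∀ w : List A, ∃ l : List (List A), (∀ x ∈ l, x ∈ X) ∧ w <:+: l.flatten

/-- `X ⊆ A*` is a regular language: accepted by a finite deterministic automaton. -/
def IsRegularLang {A : Type*} (X : Set (List A)) : Prop :=
  ∃ (Q : Type) (_ : Fintype Q) (M : DFA A Q), M.accepts = X

/-- The uniform Bernoulli measure `μ(X) = Σ_{x ∈ X} |A|^{-|x|}`. -/
noncomputable def mu (A : Type*) [Fintype A] (X : Set (List A)) : ℝ≥0∞ :=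
  ∑' x : X, ((Fintype.card A : ℝ≥0∞))⁻¹ ^ (x : List A).length

namespace Language

open scoped Computability

variable {α : Type*}

theorem IsRegular.congr {L M : Language α} (hL : L.IsRegular) (h : ∀ u, u ∈ M ↔ u ∈ L) :
    M.IsRegular :=
  (Language.ext h : M = L) ▸ hL

theorem IsRegular.mul {L M : Language α} (hL : L.IsRegular) (hM : M.IsRegular) :
    (L * M).IsRegular := by
  refine .of_finite_range_leftQuotient ?_
  have hL' := hL.finite_range_leftQuotient
  have hM' := hM.finite_range_leftQuotient.finite_subsets
  refine (hL'.image2 (fun (P : Language α) (S : Set (Language α)) => P * M + sSup S) hM').subset ?_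
  rintro _ ⟨x, rfl⟩
  refine ⟨L.leftQuotient x, ⟨x, rfl⟩,
    {Q | ∃ s t, x = s ++ t ∧ s ∈ L ∧ Q = M.leftQuotient t}, ?_, ?_⟩
  · rintro _ ⟨s, t, -, -, rfl⟩
    exact ⟨t, rfl⟩
  · ext y
    simp only [mem_add, mem_leftQuotient, mem_mul]
    have hs : ∀ S : Set (Language α), y ∈ sSup S ↔ ∃ Q ∈ S, y ∈ Q := fun S => Set.mem_sUnion
    rw [hs]
    constructor
    · rintro (⟨p, hp, m, hm, rfl⟩ | ⟨_, ⟨s, t, rfl, hs, rfl⟩, hy⟩)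
      · exact ⟨x ++ p, hp, m, hm, by simp⟩
      · exact ⟨s, hs, t ++ y, hy, by simp⟩
    · rintro ⟨p, hp, m, hm, h⟩
      rcases List.append_eq_append_iff.1 h with ⟨t, rfl, rfl⟩ | ⟨t, rfl, rfl⟩
      · exact .inr ⟨_, ⟨p, t, rfl, hp, rfl⟩, hm⟩
      · exact .inl ⟨t, hp, m, hm, rfl⟩

theorem IsRegular.kstar {L : Language α} (hL : L.IsRegular) : (L∗).IsRegular := by
  refine .of_finite_range_leftQuotient ?_
  have hL' := hL.finite_range_leftQuotient.finite_subsets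
  refine ((Set.toFinite (Set.univ : Set Prop)).image2
    (fun (p : Prop) (S : Set (Language α)) => sSup S * L∗ + ⨆ _ : p, 1) hL').subset ?_
  rintro _ ⟨x, rfl⟩
  refine ⟨x ∈ L∗, trivial,
    {Q | ∃ s t, x = s ++ t ∧ s ∈ L∗ ∧ Q = L.leftQuotient t}, ?_, ?_⟩
  · rintro _ ⟨s, t, -, -, rfl⟩
    exact ⟨t, rfl⟩
  · ext y
    simp only [mem_add, mem_leftQuotient, mem_mul, mem_iSup, mem_one, exists_prop]
    have hs : ∀ (y : List α) (S : Set (Language α)), y ∈ sSup S ↔ ∃ Q ∈ S, y ∈ Q :=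
      fun _ S => Set.mem_sUnion
    simp only [hs]
    constructor
    · rintro (⟨p, ⟨_, ⟨s, t, rfl, hs, rfl⟩, hy⟩, m, hm, rfl⟩ | ⟨hx, rfl⟩)
      · obtain ⟨l, rfl, hl⟩ := mem_kstar.1 hs
        obtain ⟨l', rfl, hl'⟩ := mem_kstar.1 hm
        refine mem_kstar.2 ⟨l ++ (t ++ p) :: l', by simp, ?_⟩
        simp only [List.mem_append, List.mem_cons]
        rintro y (h | rfl | h)
        exacts [hl y h, hy, hl' y h]
      · simpa using hx
    · intro h
      obtain ⟨l, hl, hlL⟩ := mem_kstar.1 h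
      rcases List.flatten_eq_append_iff.1 hl.symm with
        ⟨as, bs, rfl, rfl, rfl⟩ | ⟨as, bs, c, cs, ds, rfl, rfl, rfl⟩
      · cases bs with
        | nil => exact .inr ⟨join_mem_kstar fun y hy => hlL y (by simp [hy]), rfl⟩
        | cons b bs =>
          refine .inl ⟨b, ⟨_, ⟨as.flatten, [], by simp, ?_, rfl⟩, ?_⟩, bs.flatten, ?_, by simp⟩
          · exact join_mem_kstar fun y hy => hlL y (by simp [hy])
          · exact hlL _ (by simp)
          · exact join_mem_kstar fun y hy => hlL y (by simp [hy])
      · refine .inl ⟨c :: cs, ⟨_, ⟨as.flatten, bs, rfl, ?_, rfl⟩, ?_⟩, ds.flatten, ?_, by simp⟩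
        · exact join_mem_kstar fun y hy => hlL y (by simp [hy])
        · exact hlL _ (by simp)
        · exact join_mem_kstar fun y hy => hlL y (by simp [hy])

theorem IsRegular.top : (⊤ : Language α).IsRegular :=
  ⟨Unit, inferInstance, ⟨fun _ _ => (), (), Set.univ⟩, by ext; simp [DFA.mem_accepts]; trivial⟩

theorem IsRegular.singleton (z : List α) : ({z} : Language α).IsRegular := by
  refine .of_finite_range_leftQuotient ?_
  refine (((List.finite_toSet z.tails).image (fun t => ({t} : Language α))).insert ⊥).subset ?_
  rintro _ ⟨x, rfl⟩
  by_cases h : x <+: z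
  · obtain ⟨t, rfl⟩ := h
    refine .inr ⟨t, by simp, ?_⟩
    ext y
    change y = t ↔ x ++ y = x ++ t
    simp
  · refine .inl ?_
    ext y
    change x ++ y = z ↔ False
    exact iff_false_intro fun hy => h ⟨y, hy⟩

end Language

section Marker

variable {A : Type*}

/-- `z` is unbordered: no nonempty word other than `z` is both a prefix and a suffix of `z`. -/
def Unbordered (z : List A) : Prop :=
  ∀ g : List A, g ≠ [] → g <+: z → g <:+ z → g = z

theorem Unbordered.not_append_eq {z p e r r' : List A} (hz : Unbordered z) (he : e ≠ [])
    (hpe : ¬ z <:+: p ++ e) : z ++ r ≠ e ++ (z ++ r') := by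
  intro h
  rcases List.append_eq_append_iff.1 h with ⟨s, rfl, -⟩ | ⟨g, hg, hr⟩
  · exact hpe ⟨p, s, by simp⟩
  · by_cases hgn : g = []
    · subst hgn
      exact hpe ⟨p, [], by simpa using hg⟩
    · have hlen := congrArg List.length hg
      have hpos := List.length_pos_of_ne_nil he
      rw [List.length_append] at hlen
      have hpre : g <+: z :=
        List.prefix_of_prefix_length_le ⟨r, hr.symm⟩ ⟨r', rfl⟩ (by lia)
      have := hz g hgn hpre ⟨e, hg.symm⟩
      rw [this] at hlen
      lia

theorem Unbordered.cancel {z p q r r' : List A} (hz : Unbordered z)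
    (hp : ¬ z <:+: p) (hq : ¬ z <:+: q) (h : p ++ (z ++ r) = q ++ (z ++ r')) :
    p = q ∧ r = r' := by
  rcases List.append_eq_append_iff.1 h with ⟨e, rfl, he⟩ | ⟨e, rfl, he⟩
  all_goals
    by_cases hen : e = []
    · subst hen
      simpa [eq_comm] using he
  · exact absurd he (hz.not_append_eq hen hq)
  · exact absurd he (hz.not_append_eq hen hp)

theorem exists_eq_flatMap_append {z : List A} (hz : z ≠ []) (w : List A) :
    ∃ (us : List (List A)) (t : List A), (∀ u ∈ us, ¬ z <:+: u) ∧ ¬ z <:+: t ∧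
      w = us.flatMap (· ++ z) ++ t := by
  induction hn : w.length using Nat.strong_induction_on generalizing w with
  | _ n ih =>
    by_cases h : z <:+: w
    · obtain ⟨x, y, rfl⟩ := h
      have := List.length_pos_of_ne_nil hz
      simp only [List.length_append] at hn
      obtain ⟨us, t, hus, ht, hx⟩ := ih x.length (by lia) x rfl
      obtain ⟨vs, s, hvs, hs, hy⟩ := ih y.length (by lia) y rfl
      refine ⟨us ++ t :: vs, s, ?_, hs, ?_⟩
      · simp only [List.mem_append, List.mem_cons]
        rintro u (hu | rfl | hu)
        exacts [hus u hu, ht, hvs u hu]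
      · conv_lhs => rw [hx, hy]
        simp
    · exact ⟨[], w, by simp, h, by simp⟩

/-- The separating word `a ^ N * b * w * b ^ N`. -/
def separator (a b : A) (w : List A) (N : ℕ) : List A :=
  List.replicate N a ++ (b :: w ++ List.replicate N b)

variable {a b : A} {w : List A} {N : ℕ}

theorem length_separator : (separator a b w N).length = 2 * N + 1 + w.length := by
  simp only [separator, List.length_append, List.length_cons, List.length_replicate]
  lia

theorem separator_getElem?_of_lt {i : ℕ} (hi : i < N) : (separator a b w N)[i]? = some a := by
  rw [separator, List.getElem?_append_left (by simpa), List.getElem?_replicate_of_lt hi]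

theorem separator_getElem?_self : (separator a b w N)[N]? = some b := by
  rw [separator, List.getElem?_append_right (by simp)]
  simp

theorem separator_getElem?_of_ge {i : ℕ} (hi : N + 1 + w.length ≤ i)
    (hi' : i < 2 * N + 1 + w.length) : (separator a b w N)[i]? = some b := by
  rw [separator, List.getElem?_append_right (by simp; lia),
    List.getElem?_append_right (by simp; lia), List.getElem?_replicate_of_lt (by simp; lia)]

theorem unbordered_separator (hab : a ≠ b) (hN : w.length < N) :
    Unbordered (separator a b w N) := by
  rintro g hg ⟨h, hh⟩ ⟨e, he⟩
  by_contra hne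
  have hlen := congrArg List.length he
  rw [List.length_append, length_separator] at hlen
  have hgpos := List.length_pos_of_ne_nil hg
  have hepos : 0 < e.length := by
    rcases List.eq_nil_or_concat e with rfl | ⟨_, _, rfl⟩
    · exact absurd he hne
    · simp
  have key : ∀ i < g.length,
      (separator a b w N)[i]? = (separator a b w N)[e.length + i]? := by
    intro i hi
    conv_lhs => rw [← hh]
    conv_rhs => rw [← he]
    rw [List.getElem?_append_left hi, List.getElem?_append_right (by lia)]
    simp
  have contra : ∀ i < g.length, i < N →
      (separator a b w N)[e.length + i]? = some b → False := by
    intro i hi hiN hb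
    rw [← key i hi, separator_getElem?_of_lt hiN] at hb
    exact hab (Option.some.inj hb)
  by_cases h1 : g.length ≤ N
  · exact contra 0 hgpos (by lia) (separator_getElem?_of_ge (by lia) (by lia))
  · by_cases h2 : e.length ≤ N
    · refine contra (N - e.length) (by lia) (by lia) ?_
      rw [Nat.add_sub_cancel' h2, separator_getElem?_self]
    · exact contra (N - 1) (by lia) (by lia) (separator_getElem?_of_ge (by lia) (by lia))

theorem two_mul_length_add_lt_of_isPrefix_of_le {k : ℕ} (hab : a ≠ b) (hN : w.length + k < N)
    {u v c r r' : List A} (hv : ¬ separator a b w N <:+: v) (huv : u ≠ v)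
    (hle : u.length ≤ v.length)
    (h : c <+: u ++ (separator a b w N ++ r)) (h' : c <+: v ++ (separator a b w N ++ r')) :
    2 * c.length + k < (u ++ (separator a b w N ++ r)).length +
      (v ++ (separator a b w N ++ r')).length := by
  have hz : Unbordered (separator a b w N) := unbordered_separator hab (by lia)
  simp only [List.length_append, length_separator]
  by_contra! hlt
  have hl := h.length_le
  have hl' := h'.length_le
  simp only [List.length_append, length_separator] at hl hl'
  have hvc : v <+: c := List.prefix_of_prefix_length_le ⟨_, rfl⟩ h' (by lia)
  have huv' : u <+: v := List.prefix_of_prefix_length_le ⟨_, rfl⟩ (hvc.trans h) hle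
  obtain ⟨e, rfl⟩ := huv'
  have he : e ≠ [] := by
    rintro rfl
    simp at huv
  have hepos := List.length_pos_of_ne_nil he
  obtain ⟨d, rfl⟩ := hvc
  rw [List.append_assoc, List.prefix_append_right_inj] at h
  rw [List.prefix_append_right_inj] at h'
  simp only [List.length_append] at *
  have hc : e.length + d.length < 2 * N + 1 + w.length := by
    by_contra! hc
    have hzed : separator a b w N <+: e ++ d :=
      List.prefix_of_prefix_length_le ⟨_, rfl⟩ h (by simpa [length_separator] using hc)
    obtain ⟨s, hs⟩ := hzed.trans ((List.prefix_append_right_inj e).2 h')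
    exact hz.not_append_eq he hv hs
  have hget : (separator a b w N)[N]? = (separator a b w N)[N - e.length]? := by
    obtain ⟨s, hs⟩ := h
    obtain ⟨s', hs'⟩ := h'
    calc (separator a b w N)[N]?
        = (separator a b w N ++ r)[N]? :=
          (List.getElem?_append_left (by rw [length_separator]; lia)).symm
      _ = d[N - e.length]? := by
          rw [← hs, List.getElem?_append_left (by rw [List.length_append]; lia),
            List.getElem?_append_right (by lia)]
      _ = (separator a b w N ++ r')[N - e.length]? := by
          rw [← hs', List.getElem?_append_left (by lia)]
      _ = (separator a b w N)[N - e.length]? :=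
          List.getElem?_append_left (by rw [length_separator]; lia)
  rw [separator_getElem?_self, separator_getElem?_of_lt (by lia)] at hget
  exact hab (Option.some.inj hget).symm

theorem two_mul_length_add_lt_of_isPrefix {k : ℕ} (hab : a ≠ b) (hN : w.length + k < N)
    {u v c r r' : List A} (hu : ¬ separator a b w N <:+: u) (hv : ¬ separator a b w N <:+: v)
    (huv : u ≠ v)
    (h : c <+: u ++ (separator a b w N ++ r)) (h' : c <+: v ++ (separator a b w N ++ r')) :
    2 * c.length + k < (u ++ (separator a b w N ++ r)).length +
      (v ++ (separator a b w N ++ r')).length := by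
  rcases le_total u.length v.length with hle | hle
  · exact two_mul_length_add_lt_of_isPrefix_of_le hab hN hv huv hle h h'
  · rw [add_comm (List.length _)]
    exact two_mul_length_add_lt_of_isPrefix_of_le hab hN hu huv.symm hle h' h

theorem two_mul_length_add_lt_of_isPrefix_flatMap {k : ℕ} (hab : a ≠ b) (hN : w.length + k < N)
    {us vs : List (List A)} {c : List A} (hus : ∀ u ∈ us, ¬ separator a b w N <:+: u)
    (hvs : ∀ v ∈ vs, ¬ separator a b w N <:+: v) (hne : us ≠ vs)
    (h : c <+: us.flatMap (· ++ separator a b w N))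
    (h' : c <+: vs.flatMap (· ++ separator a b w N)) :
    2 * c.length + k < (us.flatMap (· ++ separator a b w N)).length +
      (vs.flatMap (· ++ separator a b w N)).length := by
  induction us generalizing vs c with
  | nil =>
    cases vs with
    | nil => exact absurd rfl hne
    | cons v vs =>
      have hc : c = [] := by simpa using h
      subst hc
      simp only [List.flatMap_cons, List.length_append, length_separator, List.length_nil]
      lia
  | cons u us ih =>
    cases vs with
    | nil =>
      have hc : c = [] := by simpa using h'
      subst hc
      simp only [List.flatMap_cons, List.length_append, length_separator, List.length_nil]
      lia
    | cons v vs =>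
      simp only [List.flatMap_cons, List.append_assoc] at h h' ⊢
      by_cases huv : u = v
      · subst huv
        by_cases hc : c.length ≤ (u ++ separator a b w N).length
        · simp only [List.length_append, length_separator] at hc ⊢
          have hlen : 2 * N + 1 + w.length ≤ (us.flatMap (· ++ separator a b w N)).length +
              (vs.flatMap (· ++ separator a b w N)).length := by
            rcases us with - | ⟨u', us⟩ <;> rcases vs with - | ⟨v', vs⟩ <;>
              first
              | exact absurd rfl hne
              | (simp only [List.flatMap_cons, List.length_append, length_separator]; lia)
          lia
        · obtain ⟨d, rfl⟩ : u ++ separator a b w N <+: c :=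
            List.prefix_of_prefix_length_le ⟨_, List.append_assoc ..⟩ h (by lia)
          simp only [List.append_assoc, List.prefix_append_right_inj] at h h'
          have := ih (fun x hx => hus x (by simp [hx])) (fun x hx => hvs x (by simp [hx]))
            (fun h => hne (by rw [h])) h h'
          simp only [List.length_append] at this ⊢
          lia
      · exact two_mul_length_add_lt_of_isPrefix hab hN (hus u (by simp)) (hvs v (by simp)) huv h h'

end Marker

section Completion

variable {A : Type*}

/-- The submonoid `X*` generated by `X`. -/
def wordStar (X : Set (List A)) : Set (List A) :=
  {u | ∃ l : List (List A), (∀ x ∈ l, x ∈ X) ∧ l.flatten = u}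

theorem nil_mem_wordStar (X : Set (List A)) : [] ∈ wordStar X :=
  ⟨[], by simp, rfl⟩

theorem mem_wordStar_of_mem {X : Set (List A)} {x : List A} (hx : x ∈ X) : x ∈ wordStar X :=
  ⟨[x], by simpa using hx, by simp⟩

theorem append_mem_wordStar {X : Set (List A)} {u v : List A} (hu : u ∈ wordStar X)
    (hv : v ∈ wordStar X) : u ++ v ∈ wordStar X := by
  obtain ⟨l, hl, rfl⟩ := hu
  obtain ⟨m, hm, rfl⟩ := hv
  refine ⟨l ++ m, ?_, by simp⟩
  simp only [List.mem_append]
  rintro x (hx | hx)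
  exacts [hl x hx, hm x hx]

theorem wordStar_mono {X Y : Set (List A)} (h : X ⊆ Y) : wordStar X ⊆ wordStar Y := by
  rintro _ ⟨l, hl, rfl⟩
  exact ⟨l, fun x hx => h (hl x hx), rfl⟩

/-- The words outside `X*` that avoid the factor `z`. -/
def fillers (X : Set (List A)) (z : List A) : Set (List A) :=
  {u | u ∉ wordStar X ∧ ¬ z <:+: u}

/-- The language `z(Uz)*`, where `U` is the set of fillers. -/
def fillerLoops (X : Set (List A)) (z : List A) : Set (List A) :=
  {y | ∃ us : List (List A), (∀ u ∈ us, u ∈ fillers X z) ∧ y = z ++ us.flatMap (· ++ z)}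

variable {X : Set (List A)} {z : List A}

theorem exists_eq_append_fillerLoop {l : List (List A)} (hl : ∀ x ∈ l, x ∈ X ∪ fillerLoops X z) :
    ∃ xs : List (List A), (∀ x ∈ xs, x ∈ X) ∧ (l = xs ∨ ∃ (us l' : List (List A)),
      (∀ u ∈ us, u ∈ fillers X z) ∧ (∀ x ∈ l', x ∈ X ∪ fillerLoops X z) ∧
        l = xs ++ (z ++ us.flatMap (· ++ z)) :: l') := by
  induction l with
  | nil => exact ⟨[], by simp, .inl rfl⟩
  | cons x l ih =>
    rcases hl x (by simp) with hx | ⟨us, hus, rfl⟩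
    · obtain ⟨xs, hxs, h⟩ := ih fun y hy => hl y (by simp [hy])
      refine ⟨x :: xs, ?_, ?_⟩
      · simp only [List.mem_cons]
        rintro y (rfl | hy)
        exacts [hx, hxs y hy]
      · rcases h with rfl | ⟨us, l', hus, hl', rfl⟩
        · exact .inl rfl
        · exact .inr ⟨us, l', hus, hl', rfl⟩
    · exact ⟨[], by simp, .inr ⟨us, l, hus, fun y hy => hl y (by simp [hy]), rfl⟩⟩

theorem ne_filler_append_flatten (hz : Unbordered z)
    (hzX : ∀ p ∈ wordStar X, ¬ z <:+: p) {l : List (List A)}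
    (hl : ∀ x ∈ l, x ∈ X ∪ fillerLoops X z) {u r : List A} (hu : u ∈ fillers X z) :
    l.flatten ≠ u ++ (z ++ r) := by
  intro h
  obtain ⟨xs, hxs, rfl | ⟨us, l', -, -, rfl⟩⟩ := exists_eq_append_fillerLoop hl
  · exact hzX _ ⟨l, hxs, rfl⟩ ⟨u, r, by simp [h]⟩
  · simp only [List.flatten_append, List.flatten_cons, List.append_assoc] at h
    obtain ⟨rfl, -⟩ := hz.cancel (hzX _ ⟨xs, hxs, rfl⟩) hu.2 h
    exact hu.1 ⟨xs, hxs, rfl⟩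

theorem flatMap_append_flatten_inj (hX : IsCode X) (hz : Unbordered z) (hzn : z ≠ [])
    (hzX : ∀ p ∈ wordStar X, ¬ z <:+: p) {us vs l m : List (List A)}
    (hus : ∀ u ∈ us, u ∈ fillers X z) (hvs : ∀ v ∈ vs, v ∈ fillers X z)
    (hl : ∀ x ∈ l, x ∈ X ∪ fillerLoops X z) (hm : ∀ x ∈ m, x ∈ X ∪ fillerLoops X z)
    (h : us.flatMap (· ++ z) ++ l.flatten = vs.flatMap (· ++ z) ++ m.flatten) :
    us = vs ∧ l = m := by
  have hzpos := List.length_pos_of_ne_nil hzn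
  induction hn : (us.flatMap (· ++ z) ++ l.flatten).length using Nat.strong_induction_on
    generalizing us vs l m with
  | _ n ih =>
    rcases us with - | ⟨u, us⟩ <;> rcases vs with - | ⟨v, vs⟩
    · refine ⟨rfl, ?_⟩
      simp only [List.flatMap_nil, List.nil_append] at h hn
      obtain ⟨xs, hxs, rfl | ⟨us, l', hus, hl', rfl⟩⟩ := exists_eq_append_fillerLoop hl <;>
        obtain ⟨ys, hys, rfl | ⟨vs, m', hvs, hm', rfl⟩⟩ := exists_eq_append_fillerLoop hm
      · exact hX _ _ hxs hys h
      · exact absurd ⟨ys.flatten, vs.flatMap (· ++ z) ++ m'.flatten, by simp [h]⟩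
          (hzX _ ⟨l, hxs, rfl⟩)
      · exact absurd ⟨xs.flatten, us.flatMap (· ++ z) ++ l'.flatten, by simp [← h]⟩
          (hzX _ ⟨m, hys, rfl⟩)
      · simp only [List.flatten_append, List.flatten_cons, List.append_assoc] at h hn
        obtain ⟨hxy, h'⟩ := hz.cancel (hzX _ ⟨xs, hxs, rfl⟩) (hzX _ ⟨ys, hys, rfl⟩) h
        obtain rfl := hX _ _ hxs hys hxy
        simp only [List.length_append] at hn
        obtain ⟨rfl, rfl⟩ := ih _ (by simp only [List.length_append]; lia) hus hvs hl' hm' h' rfl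
        rfl
    · simp only [List.flatMap_nil, List.nil_append, List.flatMap_cons, List.append_assoc] at h
      exact absurd h (ne_filler_append_flatten hz hzX hl (hvs v (by simp)))
    · simp only [List.flatMap_nil, List.nil_append, List.flatMap_cons, List.append_assoc] at h
      exact absurd h.symm (ne_filler_append_flatten hz hzX hm (hus u (by simp)))
    · simp only [List.flatMap_cons, List.append_assoc] at h hn
      obtain ⟨rfl, h'⟩ := hz.cancel (hus u (by simp)).2 (hvs v (by simp)).2 h
      simp only [List.length_append] at hn
      obtain ⟨rfl, rfl⟩ := ih _ (by simp only [List.length_append]; lia)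
        (fun x hx => hus x (by simp [hx])) (fun x hx => hvs x (by simp [hx])) hl hm h' rfl
      exact ⟨rfl, rfl⟩

theorem isCode_union_fillerLoops (hX : IsCode X) (hz : Unbordered z) (hzn : z ≠ [])
    (hzX : ∀ p ∈ wordStar X, ¬ z <:+: p) : IsCode (X ∪ fillerLoops X z) :=
  fun _ _ hl hm h => (flatMap_append_flatten_inj hX hz hzn hzX (us := []) (vs := [])
    (by simp) (by simp) hl hm (by simpa using h)).2

theorem fillerLoop_append_mem_wordStar {y : List A} (hy : y ∈ fillerLoops X z)
    {us : List (List A)} (hus : ∀ u ∈ us, ¬ z <:+: u) :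
    y ++ us.flatMap (· ++ z) ∈ wordStar (X ∪ fillerLoops X z) := by
  induction us generalizing y with
  | nil => simpa using mem_wordStar_of_mem (.inr hy)
  | cons u us ih =>
    have ih' := fun {y} (hy : y ∈ fillerLoops X z) => ih hy fun v hv => hus v (by simp [hv])
    by_cases hu : u ∈ wordStar X
    · have := append_mem_wordStar (mem_wordStar_of_mem (.inr hy))
        (append_mem_wordStar (wordStar_mono Set.subset_union_left hu)
          (ih' ⟨[], by simp, by simp⟩ : z ++ _ ∈ _))
      simpa using this
    · obtain ⟨vs, hvs, rfl⟩ := hy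
      have : z ++ (vs ++ [u]).flatMap (· ++ z) ∈ fillerLoops X z := by
        refine ⟨_, ?_, rfl⟩
        simp only [List.mem_append, List.mem_singleton]
        rintro v (hv | rfl)
        exacts [hvs v hv, ⟨hu, hus _ (by simp)⟩]
      simpa using ih' this

theorem isCompleteSet_union_fillerLoops (hzn : z ≠ []) :
    IsCompleteSet (X ∪ fillerLoops X z) := by
  intro w
  obtain ⟨us, t, hus, ht, rfl⟩ := exists_eq_flatMap_append hzn w
  obtain ⟨l, hl, h⟩ := fillerLoop_append_mem_wordStar (X := X) (z := z) (y := z)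
    ⟨[], by simp, by simp⟩ (us := us ++ [t]) (by
      simp only [List.mem_append, List.mem_singleton]
      rintro u (hu | rfl)
      exacts [hus u hu, ht])
  exact ⟨l, hl, z, z, by simp [h]⟩

open scoped Computability in
theorem isRegular_union_fillerLoops (hX : Language.IsRegular (X : Language A)) :
    Language.IsRegular (X ∪ fillerLoops X z : Set (List A)) := by
  have hz := Language.IsRegular.singleton z
  have hU : Language.IsRegular (fillers X z : Set (List A)) := by
    refine (hX.kstar.compl.inf ((Language.IsRegular.top.mul hz).mul .top).compl).congr fun u => ?_
    refine and_congr (not_congr ?_) (not_congr ?_)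
    · exact exists_congr fun l => ⟨fun h => ⟨h.2.symm, h.1⟩, fun h => ⟨h.2, h.1.symm⟩⟩
    · constructor
      · rintro ⟨s, t, rfl⟩
        exact Language.append_mem_mul (Language.append_mem_mul trivial rfl) trivial
      · intro h
        obtain ⟨_, hp, t, -, rfl⟩ := Language.mem_mul.1 h
        obtain ⟨s, -, _, rfl, rfl⟩ := Language.mem_mul.1 hp
        exact ⟨s, t, rfl⟩
  refine hX.add ?_
  refine (hz.mul (hU.mul hz).kstar).congr fun y => ?_
  rw [Language.mem_mul]
  constructor
  · rintro ⟨us, hus, rfl⟩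
    refine ⟨z, rfl, _, ?_, rfl⟩
    refine Language.mem_kstar.2 ⟨us.map (· ++ z), by rw [List.flatMap_def], ?_⟩
    simp only [List.mem_map]
    rintro _ ⟨u, hu, rfl⟩
    exact Language.append_mem_mul (hus u hu) rfl
  · rintro ⟨z', hz', r, hr, rfl⟩
    rw [show z' = z from hz']
    obtain ⟨l, rfl, hl⟩ := Language.mem_kstar.1 hr
    suffices ∃ us : List (List A), (∀ u ∈ us, u ∈ fillers X z) ∧ l = us.map (· ++ z) by
      obtain ⟨us, hus, rfl⟩ := this
      exact ⟨us, hus, by rw [List.flatMap_def]⟩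
    clear hr
    induction l with
    | nil => exact ⟨[], by simp, rfl⟩
    | cons x l ih =>
      obtain ⟨us, hus, rfl⟩ := ih fun y hy => hl y (by simp [hy])
      obtain ⟨u, hu, z'', hz'', rfl⟩ := Language.mem_mul.1 (hl x (by simp))
      rw [show z'' = z from hz'']
      refine ⟨u :: us, ?_, rfl⟩
      simp only [List.mem_cons]
      rintro v (rfl | hv)
      exacts [hu, hus v hv]

theorem lt_dP_of_forall_isPrefix {k : ℕ} {x y : List A}
    (h : ∀ c, c <+: x → c <+: y → 2 * c.length + k < x.length + y.length) : k < dP x y := by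
  obtain ⟨c, hc, hx, hy⟩ : lcpLen x y ∈ {n | ∃ p : List A, p.length = n ∧ p <+: x ∧ p <+: y} :=
    Nat.sSup_mem ⟨0, [], rfl, List.nil_prefix, List.nil_prefix⟩
      ⟨x.length, by rintro _ ⟨p, rfl, hp, -⟩; exact hp.length_le⟩
  have := h c hx hy
  rw [dP, ← hc]
  lia

theorem dP_comm (x y : List A) : dP x y = dP y x := by
  simp only [dP, lcpLen, add_comm x.length, and_comm]

variable {a b : A} {w : List A} {N k : ℕ}

theorem lt_dP_of_mem_of_mem_fillerLoops (hN : w.length + k < N)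
    (hw : ∀ p ∈ wordStar X, ¬ w <:+: p) {x y : List A} (hx : x ∈ X)
    (hy : y ∈ fillerLoops X (separator a b w N)) : k < dP x y := by
  obtain ⟨us, -, rfl⟩ := hy
  refine lt_dP_of_forall_isPrefix fun c hcx hcy => ?_
  have hc : c.length < N + 1 + w.length := by
    by_contra! hc
    have hpre : List.replicate N a ++ b :: w <+: c := by
      refine List.prefix_of_prefix_length_le ?_ hcy (by simp; lia)
      exact ⟨List.replicate N b ++ us.flatMap (· ++ separator a b w N), by simp [separator]⟩
    refine hw x (mem_wordStar_of_mem hx) (List.IsInfix.trans ?_ (hpre.trans hcx).isInfix)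
    exact ⟨List.replicate N a ++ [b], [], by simp⟩
  have := hcx.length_le
  simp only [List.length_append, length_separator]
  lia

theorem lt_dP_of_mem_fillerLoops (hab : a ≠ b) (hN : w.length + k < N) {x y : List A}
    (hx : x ∈ fillerLoops X (separator a b w N)) (hy : y ∈ fillerLoops X (separator a b w N))
    (hxy : x ≠ y) : k < dP x y := by
  obtain ⟨us, hus, rfl⟩ := hx
  obtain ⟨vs, hvs, rfl⟩ := hy
  have hnil : ¬ separator a b w N <:+: [] := fun h => by
    have := h.length_le
    simp [length_separator] at this
  have hfree : ∀ {us : List (List A)}, (∀ u ∈ us, u ∈ fillers X (separator a b w N)) →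
      ∀ u ∈ [] :: us, ¬ separator a b w N <:+: u := by
    intro us hus u hu
    rcases List.mem_cons.1 hu with rfl | hu
    exacts [hnil, (hus u hu).2]
  refine lt_dP_of_forall_isPrefix fun c hcx hcy => ?_
  have := two_mul_length_add_lt_of_isPrefix_flatMap (c := c) hab hN (hfree hus) (hfree hvs)
    (fun h => hxy (by rw [(List.cons.inj h).2])) (by simpa using hcx) (by simpa using hcy)
  simpa using this

end Completion

/-- every regular `P̲_k`-independent code embeds in a complete
(`P̲_k`-independent, regular) code. -/
theorem stmt_12 {A : Type*} [Fintype A] (hA : 2 ≤ Fintype.card A)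
    (k : ℕ) (hk : 1 ≤ k) (X : Set (List A))
    (hreg : IsRegularLang X) (hcode : IsCode X)
    (hind : ¬ ∃ x ∈ X, ∃ y ∈ X, x ≠ y ∧ dP x y ≤ k) :
    ∃ Z : Set (List A), X ⊆ Z ∧ IsCode Z ∧ IsCompleteSet Z ∧
      (¬ ∃ x ∈ Z, ∃ y ∈ Z, x ≠ y ∧ dP x y ≤ k) ∧ IsRegularLang Z := by
  by_cases hcomp : IsCompleteSet X
  · exact ⟨X, subset_rfl, hcode, hcomp, hind, hreg⟩
  obtain ⟨w, hw⟩ : ∃ w : List A, ∀ p ∈ wordStar X, ¬ w <:+: p := by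
    simp only [IsCompleteSet, not_forall, not_exists, not_and] at hcomp
    obtain ⟨w, hw⟩ := hcomp
    refine ⟨w, ?_⟩
    rintro _ ⟨l, hl, rfl⟩
    exact hw l hl
  obtain ⟨a, b, hab⟩ := Fintype.exists_pair_of_one_lt_card hA
  obtain ⟨N, hN⟩ : ∃ N, w.length + k < N := ⟨_, Nat.lt_succ_self _⟩
  have hwz : w <:+: separator a b w N :=
    ⟨List.replicate N a ++ [b], List.replicate N b, by simp [separator]⟩
  have hz : Unbordered (separator a b w N) := unbordered_separator hab (by lia)
  have hzn : separator a b w N ≠ [] :=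
    List.ne_nil_of_length_pos (by rw [length_separator]; lia)
  refine ⟨X ∪ fillerLoops X (separator a b w N), Set.subset_union_left,
    isCode_union_fillerLoops hcode hz hzn fun p hp h => hw p hp (hwz.trans h),
    isCompleteSet_union_fillerLoops hzn, ?_, isRegular_union_fillerLoops hreg⟩
  rintro ⟨x, hx | hx, y, hy | hy, hxy, hd⟩
  · exact hind ⟨x, hx, y, hy, hxy, hd⟩
  · exact hd.not_gt (lt_dP_of_mem_of_mem_fillerLoops hN hw hx hy)
  · rw [dP_comm] at hd
    exact hd.not_gt (lt_dP_of_mem_of_mem_fillerLoops hN hw hy hx)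
  · exact hd.not_gt (lt_dP_of_mem_fillerLoops hab hN hx hy hxy)
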